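/- arXiv:1508.06141 — 2 statements merged into one kernel-verified Lean document; each statement's English description precedes it below -/
import Mathlib

section
/- Let (G,θ) be a valued digraph and A an initial section. Let N(A) = {x ∈ A : θ(x) = 0} and F(A) = {x ∈ A : A ∖ {x} is an initial section}. Then the Möbius function of the poset of initial sections satisfies μ(∅, A) = (-1)^{|N(A)|} if F(A) = N(A), and μ(∅, A) = 0 otherwise. In particular μ takes values in {-1, 0, 1}. -/
open scoped Classical

variable {V : Type*}

/-- A digraph is acyclic when its transitive closure is irreflexive. -/
def Acyclic (E : V → V → Prop) : Prop := ∀ x, ¬ Relation.TransGen E x x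

/-- `θ` is an out-degree compatible valuation: `θ x ≤ d⁺(x)` for every vertex. -/
def IsOCV (E : V → V → Prop) (θ : V → ℕ) : Prop :=
  ∀ x, ∃ s : Finset V, (∀ y ∈ s, E x y) ∧ θ x ≤ s.card

/-- The current valuation after the vertices of `R` have been peeled. -/
noncomputable def curVal (E : V → V → Prop) (θ : V → ℕ) (R : Finset V) (x : V) : ℕ :=
  θ x - (R.filter fun y => E x y).card

/-- `x` is erasable in the valued digraph obtained after peeling the vertices of `R`. -/
def ErasableAt (E : V → V → Prop) (θ : V → ℕ) (R : Finset V) (x : V) : Prop :=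
  x ∉ R ∧ curVal E θ R x = 0 ∧ ∀ z, z ∉ R → E z x → curVal E θ R z ≠ 0

/-- `PeelFrom E θ R L`: starting from the state where `R` has been peeled, the
list `L` is a valid sequence of successive peelings. -/
def PeelFrom (E : V → V → Prop) (θ : V → ℕ) : Finset V → List V → Prop
  | _, [] => True
  | R, x :: L => ErasableAt E θ R x ∧ PeelFrom E θ (insert x R) L

/-- `A` is an initial section of some peeling sequence of the valued digraph `(G, θ)`. -/
def IsInitialSection (E : V → V → Prop) (θ : V → ℕ) (A : Finset V) : Prop :=
  ∃ L : List V, PeelFrom E θ ∅ L ∧ L.toFinset = A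


theorem exists_source (E : V → V → Prop) (hac : Acyclic E) (s : Finset V) (hs : s.Nonempty) :
    ∃ x ∈ s, ∀ z ∈ s, ¬ E z x := by
  haveI : IsStrictOrder V (Relation.TransGen E) :=
    { irrefl := hac, trans := fun _ _ _ h1 h2 => Relation.TransGen.trans h1 h2 }
  have hwf := Finset.wellFoundedOn (r := Relation.TransGen E) s
  rw [Set.wellFoundedOn_iff] at hwf
  obtain ⟨x, hx, hmin⟩ := hwf.has_min (s : Set V) hs
  exact ⟨x, hx, fun z hz h => hmin z hz ⟨Relation.TransGen.single h, hz, hx⟩⟩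

theorem exists_sink (E : V → V → Prop) (hac : Acyclic E) (s : Finset V) (hs : s.Nonempty) :
    ∃ x ∈ s, ∀ z ∈ s, ¬ E x z := by
  have h : Acyclic (Function.swap E) := by
    intro x hx
    rw [Relation.transGen_swap] at hx
    exact hac x hx
  exact exists_source (Function.swap E) h s hs

/-- number of out-neighbours in `A`. -/
noncomputable def dg (E : V → V → Prop) (A : Finset V) (x : V) : ℕ :=
  (A.filter fun y => E x y).card

def QSec (E : V → V → Prop) (θ : V → ℕ) (A : Finset V) : Prop :=
  (∀ x ∈ A, θ x ≤ dg E A x) ∧ ∀ x, x ∉ A → dg E A x ≤ θ x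

theorem dg_mono (E : V → V → Prop) {A B : Finset V} (h : A ⊆ B) (x : V) :
    dg E A x ≤ dg E B x :=
  Finset.card_le_card (Finset.filter_subset_filter _ h)

theorem dg_insert (E : V → V → Prop) {A : Finset V} {a : V} (ha : a ∉ A) (x : V) :
    dg E (insert a A) x = dg E A x + if E x a then 1 else 0 := by
  unfold dg
  rw [Finset.filter_insert]
  split_ifs with h
  · rw [Finset.card_insert_of_notMem]
    simp [ha]
  · rfl

theorem dg_erase (E : V → V → Prop) {A : Finset V} {a : V} (ha : a ∈ A) (x : V) :
    dg E A x = dg E (A.erase a) x + if E x a then 1 else 0 := by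
  have := dg_insert E (Finset.notMem_erase a A) x
  rwa [Finset.insert_erase ha] at this

theorem QSec_insert (E : V → V → Prop) (θ : V → ℕ) {R : Finset V} {x : V}
    (hR : QSec E θ R) (hx : ErasableAt E θ R x) : QSec E θ (insert x R) := by
  obtain ⟨h1, h2, h3⟩ := hx
  have hm := dg_mono E (Finset.subset_insert x R)
  refine ⟨fun y hy => ?_, fun y hy => ?_⟩
  · rcases Finset.mem_insert.1 hy with rfl | hy
    · refine le_trans ?_ (hm y)
      change θ y - dg E R y = 0 at h2
      omega
    · exact (hR.1 y hy).trans (hm y)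
  · have hyR : y ∉ R := fun h => hy (Finset.mem_insert_of_mem h)
    have := hR.2 y hyR
    rw [dg_insert E h1]
    split_ifs with h
    · have h4 : θ y - dg E R y ≠ 0 := h3 y hyR h
      omega
    · simpa using this

theorem QSec_of_peel (E : V → V → Prop) (θ : V → ℕ) (L : List V) :
    ∀ R : Finset V, QSec E θ R → PeelFrom E θ R L → QSec E θ (R ∪ L.toFinset) := by
  induction L with
  | nil => intro R hR _; simpa using hR
  | cons x L ih =>
    intro R hR h
    have := ih _ (QSec_insert E θ hR h.1) h.2
    have e : insert x R ∪ L.toFinset = R ∪ (x :: L).toFinset := by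
      ext a; simp
    rwa [e] at this

theorem peel_append (E : V → V → Prop) (θ : V → ℕ) (L : List V) (x : V) :
    ∀ R : Finset V, PeelFrom E θ R L → ErasableAt E θ (R ∪ L.toFinset) x →
      PeelFrom E θ R (L ++ [x]) := by
  induction L with
  | nil => intro R _ h; exact ⟨by simpa using h, trivial⟩
  | cons y L ih =>
    intro R hR h
    refine ⟨hR.1, ih _ hR.2 ?_⟩
    have e : insert y R ∪ L.toFinset = R ∪ (y :: L).toFinset := by
      ext a; simp
    rwa [e]

theorem QSec_erase (E : V → V → Prop) (θ : V → ℕ) (hac : Acyclic E) {A : Finset V} {x : V}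
    (hA : QSec E θ A) (hx : x ∈ A) (h1 : dg E A x = θ x)
    (h2 : ∀ z ∈ A, E z x → dg E A z ≠ θ z) : QSec E θ (A.erase x) := by
  have hm := dg_mono E (Finset.erase_subset x A)
  refine ⟨fun y hy => ?_, fun y hy => ?_⟩
  · have hyA := Finset.mem_of_mem_erase hy
    have h3 := dg_erase E hx y
    have h4 := hA.1 y hyA
    split_ifs at h3 with h
    · have := h2 y hyA h
      omega
    · omega
  · by_cases hyx : y = x
    · subst hyx; exact h1 ▸ hm y
    · have : y ∉ A := fun h => hy (Finset.mem_erase.2 ⟨hyx, h⟩)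
      exact (hm y).trans (hA.2 y this)

theorem QSec_exists (E : V → V → Prop) (θ : V → ℕ) (hac : Acyclic E) {A : Finset V}
    (hA : QSec E θ A) (hne : A.Nonempty) : ∃ x ∈ A, dg E A x = θ x ∧
      ∀ z ∈ A, E z x → dg E A z ≠ θ z := by
  have hT : (A.filter fun x => dg E A x = θ x).Nonempty := by
    obtain ⟨x, hx, hs⟩ := exists_sink E hac A hne
    refine ⟨x, Finset.mem_filter.2 ⟨hx, ?_⟩⟩
    have h0 : dg E A x = 0 := by
      unfold dg
      rw [Finset.card_eq_zero, Finset.filter_eq_empty_iff]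
      exact fun {z} hz => hs z hz
    have := hA.1 x hx
    omega
  obtain ⟨x, hx, hs⟩ := exists_source E hac _ hT
  rw [Finset.mem_filter] at hx
  exact ⟨x, hx.1, hx.2, fun z hz he h => hs z (Finset.mem_filter.2 ⟨hz, h⟩) he⟩

theorem initial_iff (E : V → V → Prop) (θ : V → ℕ) (hac : Acyclic E) (A : Finset V) :
    IsInitialSection E θ A ↔ QSec E θ A := by
  constructor
  · rintro ⟨L, hL, rfl⟩
    have := QSec_of_peel E θ L ∅ ⟨by simp, by simp [dg]⟩ hL
    simpa using this
  · induction A using Finset.strongInduction with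
    | H A ih =>
      intro hA
      rcases A.eq_empty_or_nonempty with rfl | hne
      · exact ⟨[], trivial, rfl⟩
      · obtain ⟨x, hx, h1, h2⟩ := QSec_exists E θ hac hA hne
        obtain ⟨L, hL, hLA⟩ := ih _ (Finset.erase_ssubset hx) (QSec_erase E θ hac hA hx h1 h2)
        refine ⟨L ++ [x], peel_append E θ L x ∅ hL ?_, ?_⟩
        · rw [Finset.empty_union, hLA]
          have hirr : ∀ y, ¬ E y y := fun y h => hac y (Relation.TransGen.single h)
          refine ⟨Finset.notMem_erase x A, ?_, ?_⟩
          · change θ x - dg E (A.erase x) x = 0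
            have := dg_erase E hx x
            rw [if_neg (hirr x)] at this
            omega
          · intro z hz he
            change θ z - dg E (A.erase x) z ≠ 0
            have hzA : z ∉ A := fun h => hz (Finset.mem_erase.2
              ⟨by rintro rfl; exact hirr _ he, h⟩)
            have h3 := hA.2 z hzA
            have := dg_erase E hx z
            rw [if_pos he] at this
            omega
        · rw [List.toFinset_append, hLA]
          ext a
          simp only [Finset.mem_union, Finset.mem_erase, List.mem_toFinset, List.mem_singleton]
          by_cases h : a = x
          · simp [h, hx]
          · simp [h]

noncomputable def FSet (E : V → V → Prop) (θ : V → ℕ) (A : Finset V) : Finset V :=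
  A.filter (fun x => QSec E θ (A.erase x))

noncomputable def NSet (θ : V → ℕ) (A : Finset V) : Finset V := A.filter (fun x => θ x = 0)

theorem tight_mem_F (E : V → V → Prop) (θ : V → ℕ) (hac : Acyclic E) {B : Finset V}
    (hB : QSec E θ B) (hF : FSet E θ B ⊆ NSet θ B) {t : V} (ht : t ∈ B)
    (htight : dg E B t = θ t) : t ∈ FSet E θ B := by
  by_contra hcon
  obtain ⟨x, hx, hs⟩ := exists_source E hac
    (B.filter fun x => dg E B x = θ x ∧ x ∉ FSet E θ B)
    ⟨t, Finset.mem_filter.2 ⟨ht, htight, hcon⟩⟩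
  obtain ⟨hxB, hxt, hxF⟩ := Finset.mem_filter.1 hx
  apply hxF
  refine Finset.mem_filter.2 ⟨hxB, QSec_erase E θ hac hB hxB hxt ?_⟩
  intro z hz he hzt
  by_cases hzF : z ∈ FSet E θ B
  · have h0 := (Finset.mem_filter.1 (hF hzF)).2
    rw [h0] at hzt
    unfold dg at hzt
    rw [Finset.card_eq_zero, Finset.filter_eq_empty_iff] at hzt
    exact hzt hxB he
  · exact hs z (Finset.mem_filter.2 ⟨hz, hzt, hzF⟩) he

theorem QSec_min (E : V → V → Prop) (θ : V → ℕ) (hac : Acyclic E) {B C S : Finset V}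
    (hB : QSec E θ B) (hC : QSec E θ C) (hFS : FSet E θ B ⊆ S) (hSN : S ⊆ NSet θ B)
    (hSC : S ⊆ C) : B ⊆ C := by
  by_contra hcon
  have hne : (B \ C).Nonempty := by
    rwa [Finset.sdiff_nonempty]
  obtain ⟨z, hz, hs⟩ := exists_sink E hac _ hne
  obtain ⟨hzB, hzC⟩ := Finset.mem_sdiff.1 hz
  apply hzC
  apply hSC
  apply hFS
  apply tight_mem_F E θ hac hB (hFS.trans hSN) hzB
  apply le_antisymm _ (hB.1 z hzB)
  refine le_trans ?_ (hC.2 z hzC)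
  apply Finset.card_le_card
  intro y hy
  obtain ⟨hyB, he⟩ := Finset.mem_filter.1 hy
  refine Finset.mem_filter.2 ⟨?_, he⟩
  by_contra hyC
  exact hs y (Finset.mem_sdiff.2 ⟨hyB, hyC⟩) he

noncomputable def fval (E : V → V → Prop) (θ : V → ℕ) (A : Finset V) : ℤ :=
  if FSet E θ A = NSet θ A then (-1) ^ (NSet θ A).card else 0

theorem sum_Icc_sign (F N : Finset V) :
    ∑ S ∈ N.powerset, (if F ⊆ S then (-1 : ℤ) ^ S.card else 0)
      = if F = N then (-1) ^ N.card else 0 := by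
  by_cases hFN : F ⊆ N
  · have h := Finset.sum_powerset_neg_one_pow_card (x := N \ F)
    rw [← Finset.sum_filter]
    have e : ∑ S ∈ N.powerset.filter (fun S => F ⊆ S), (-1 : ℤ) ^ S.card
        = ∑ T ∈ (N \ F).powerset, (-1 : ℤ) ^ F.card * (-1) ^ T.card := by
      refine Finset.sum_bij' (fun S _ => S \ F) (fun T _ => T ∪ F) ?_ ?_ ?_ ?_ ?_
      · intro S hS
        simp only [Finset.mem_filter, Finset.mem_powerset] at hS ⊢
        exact Finset.sdiff_subset_sdiff hS.1 le_rfl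
      · intro T hT
        simp only [Finset.mem_filter, Finset.mem_powerset] at hT ⊢
        exact ⟨Finset.union_subset (hT.trans Finset.sdiff_subset) hFN, Finset.subset_union_right⟩
      · intro S hS
        simp only [Finset.mem_filter, Finset.mem_powerset] at hS
        exact Finset.sdiff_union_of_subset hS.2
      · intro T hT
        simp only [Finset.mem_powerset] at hT
        ext a
        have := @hT a
        simp only [Finset.mem_sdiff, Finset.mem_union] at this ⊢
        tauto
      · intro S hS
        simp only [Finset.mem_filter, Finset.mem_powerset] at hS
        rw [← pow_add, add_comm, Finset.card_sdiff_add_card_eq_card hS.2]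
    rw [e, ← Finset.mul_sum, h]
    by_cases hEq : F = N
    · simp [hEq]
    · rw [if_neg hEq, if_neg, mul_zero]
      intro h0
      exact hEq (hFN.antisymm (Finset.sdiff_eq_empty_iff_subset.1 h0))
  · rw [if_neg (fun h => hFN h.le)]
    apply Finset.sum_eq_zero
    intro S hS
    rw [if_neg]
    exact fun h => hFN (h.trans (Finset.mem_powerset.1 hS))

theorem sum_fval (E : V → V → Prop) (θ : V → ℕ) (hac : Acyclic E) {A : Finset V}
    (hA : QSec E θ A) (hne : A ≠ ∅) :
    ∑ B ∈ A.powerset.filter (QSec E θ), fval E θ B = 0 := by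
  have step : ∀ B ∈ A.powerset.filter (QSec E θ), fval E θ B =
      ∑ S ∈ (NSet θ A).powerset,
        if S ⊆ B ∧ FSet E θ B ⊆ S then (-1 : ℤ) ^ S.card else 0 := by
    intro B hB
    simp only [Finset.mem_filter, Finset.mem_powerset] at hB
    rw [fval, ← sum_Icc_sign]
    simp_rw [ite_and]
    rw [← Finset.sum_filter (fun S => S ⊆ B)]
    refine Finset.sum_congr ?_ (fun _ _ => rfl)
    ext S
    simp only [Finset.mem_filter, Finset.mem_powerset, NSet, Finset.subset_iff]
    constructor
    · intro h
      exact ⟨fun x hx => ⟨hB.1 (h hx).1, (h hx).2⟩, fun x hx => (h hx).1⟩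
    · intro h x hx
      exact ⟨h.2 hx, (h.1 hx).2⟩
  rw [Finset.sum_congr rfl step, Finset.sum_comm]
  have step2 : ∀ S ∈ (NSet θ A).powerset,
      ∑ B ∈ A.powerset.filter (QSec E θ),
        (if S ⊆ B ∧ FSet E θ B ⊆ S then (-1 : ℤ) ^ S.card else 0) = (-1) ^ S.card := by
    intro S hS
    rw [Finset.mem_powerset] at hS
    have hSA : S ⊆ A := hS.trans (Finset.filter_subset _ _)
    obtain ⟨B, hBm, hmin⟩ := Finset.exists_min_image
      (A.powerset.filter fun B => QSec E θ B ∧ S ⊆ B) Finset.card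
      ⟨A, by simp [hA, hSA]⟩
    simp only [Finset.mem_filter, Finset.mem_powerset] at hBm hmin
    obtain ⟨hBA, hBQ, hSB⟩ := hBm
    have hFB : FSet E θ B ⊆ S := by
      intro x hx
      obtain ⟨hxB, hxQ⟩ := Finset.mem_filter.1 hx
      by_contra hxS
      have := hmin (B.erase x) ⟨(Finset.erase_subset _ _).trans hBA, hxQ,
        Finset.subset_erase.2 ⟨hSB, hxS⟩⟩
      have := Finset.card_erase_lt_of_mem hxB
      omega
    have hN : ∀ C, S ⊆ C → S ⊆ NSet θ C := fun C hC x hx =>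
      Finset.mem_filter.2 ⟨hC hx, (Finset.mem_filter.1 (hS hx)).2⟩
    rw [Finset.sum_eq_single B]
    · rw [if_pos ⟨hSB, hFB⟩]
    · intro C hC hCB
      rw [if_neg]
      rintro ⟨h1, h2⟩
      have hCQ := (Finset.mem_filter.1 hC).2
      exact hCB ((QSec_min E θ hac hCQ hBQ h2 (hN C h1) hSB).antisymm
        (QSec_min E θ hac hBQ hCQ hFB (hN B hSB) h1))
    · intro h
      exact absurd (Finset.mem_filter.2 ⟨Finset.mem_powerset.2 hBA, hBQ⟩) h
  rw [Finset.sum_congr rfl step2, Finset.sum_powerset_neg_one_pow_card, if_neg]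
  intro h0
  obtain ⟨x, hx, hs⟩ := exists_sink E hac A (Finset.nonempty_iff_ne_empty.2 hne)
  have hd : dg E A x = 0 := by
    unfold dg
    rw [Finset.card_eq_zero, Finset.filter_eq_empty_iff]
    exact fun {z} hz => hs z hz
  have h1 := hA.1 x hx
  have : x ∈ NSet θ A := Finset.mem_filter.2 ⟨hx, by omega⟩
  rw [h0] at this
  simp at this

/-- values of the Möbius function of the poset of initial sections.
With `N(A) = {x ∈ A : θ x = 0}` and `F(A) = {x ∈ A : A \ {x} is an initial
section}`, and `μ` satisfying the defining recursion of the Möbius function on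
intervals `[∅, A]`, we have `μ(∅,A) = (-1)^{|N(A)|}` if `F(A) = N(A)` and
`μ(∅,A) = 0` otherwise; in particular `μ(∅,A) ∈ {-1,0,1}`. -/
theorem mobius_initialSections (E : V → V → Prop) (θ : V → ℕ)
    (hac : Acyclic E) (hocv : IsOCV E θ) (μ : Finset V → ℤ)
    (hμ0 : μ ∅ = 1)
    (hμrec : ∀ A : Finset V, IsInitialSection E θ A → A ≠ ∅ →
      ∑ B ∈ A.powerset.filter (IsInitialSection E θ), μ B = 0)
    (A : Finset V) (hA : IsInitialSection E θ A) :
    (A.filter (fun x => IsInitialSection E θ (A.erase x)) = A.filter (fun x => θ x = 0) →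
        μ A = (-1) ^ (A.filter fun x => θ x = 0).card) ∧
    (A.filter (fun x => IsInitialSection E θ (A.erase x)) ≠ A.filter (fun x => θ x = 0) →
        μ A = 0) ∧
    (μ A = -1 ∨ μ A = 0 ∨ μ A = 1) := by
  have hI : IsInitialSection E θ = QSec E θ := by
    funext B
    exact propext (initial_iff E θ hac B)
  have key : ∀ B : Finset V, QSec E θ B → μ B = fval E θ B := by
    intro B
    induction B using Finset.strongInduction with
    | H B ih =>
      intro hB
      by_cases hne : B = ∅
      · subst hne
        simp [hμ0, fval, FSet, NSet]
      · have h1 := hμrec B ((initial_iff E θ hac B).2 hB) hne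
        have h2 := sum_fval E θ hac hB hne
        have hmem : B ∈ B.powerset.filter (QSec E θ) := by simp [hB]
        simp only [hI] at h1
        rw [← Finset.add_sum_erase _ _ hmem] at h1 h2
        have h3 : ∑ C ∈ (B.powerset.filter (QSec E θ)).erase B, μ C
            = ∑ C ∈ (B.powerset.filter (QSec E θ)).erase B, fval E θ C := by
          refine Finset.sum_congr rfl fun C hC => ?_
          simp only [Finset.mem_erase, Finset.mem_filter, Finset.mem_powerset] at hC
          exact ih C (lt_of_le_of_ne hC.2.1 hC.1) hC.2.2
        linarith
  have hval := key A ((initial_iff E θ hac A).1 hA)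
  rw [hI, hval]
  change (FSet E θ A = NSet θ A → fval E θ A = (-1) ^ (NSet θ A).card) ∧
    (FSet E θ A ≠ NSet θ A → fval E θ A = 0) ∧ _
  refine ⟨fun h => if_pos h, fun h => if_neg h, ?_⟩
  unfold fval
  split_ifs
  · rcases neg_one_pow_eq_or ℤ (NSet θ A).card with h | h <;> simp [h]
  · simp
end

section
/- Define the shifted valued digraph ℬ on λ_n^s = {(a,b) ∈ [±n]² : |a| < b or -a = b} (equivalently |a| ≤ b, a < b), with arcs from (a,b) to every element of the shifted hook H̃(a,b) = {(a,k), (k,b), (-k,-a) : a < k < b} ∩ λ_n^s other than (a,b) itself, and valuation θ(c) = d⁺(c)/2. Then IS(ℬ) = {Inv_B(ω) : ω ∈ B_n}, and the poset (IS(ℬ), ⊆) is isomorphic to the right weak order on B_n. -/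
open scoped Classical

variable {V : Type*}

/-- `ω` is a signed permutation of `[±n]`: a bijection of `ℤ` with
`ω(-m) = -ω(m)`, fixing every integer of absolute value greater than `n`
(so it restricts to a bijection of `{-n,…,-1,1,…,n}`). -/
def IsSigned (n : ℕ) (ω : Equiv.Perm ℤ) : Prop :=
  (∀ m : ℤ, ω (-m) = -ω m) ∧ ∀ m : ℤ, (n : ℤ) < |m| → ω m = m

/-- The `B`-inversion set of a signed permutation:
`Inv_B(ω) = {(a,b) ∈ [±n]² : a < b, |a| ≤ b, ω⁻¹ a > ω⁻¹ b}`. -/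
def InvBSet (n : ℕ) (ω : Equiv.Perm ℤ) : Set (ℤ × ℤ) :=
  {p | p.1 ≠ 0 ∧ p.2 ≠ 0 ∧ -(n : ℤ) ≤ p.1 ∧ p.2 ≤ (n : ℤ) ∧ p.1 < p.2 ∧
    |p.1| ≤ p.2 ∧ ω⁻¹ p.2 < ω⁻¹ p.1}

/-- The Coxeter generators of `B_n` as signed permutations: `s_0 = (1,-1)` and
`s_i = (i,i+1)(-i,-(i+1))` for `1 ≤ i ≤ n-1`. -/
def BGen (n : ℕ) (s : Equiv.Perm ℤ) : Prop :=
  s = Equiv.swap (1 : ℤ) (-1) ∨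
    ∃ i : ℕ, 1 ≤ i ∧ i < n ∧
      s = Equiv.swap (i : ℤ) ((i : ℤ) + 1) * Equiv.swap (-(i : ℤ)) (-((i : ℤ) + 1))

/-- Coxeter length on `B_n`: minimal length of an expression as a product of
the generators. -/
noncomputable def blen (n : ℕ) (ω : Equiv.Perm ℤ) : ℕ :=
  sInf {k | ∃ l : List (Equiv.Perm ℤ), (∀ s ∈ l, BGen n s) ∧ l.length = k ∧ ω = l.prod}

/-- The right weak order on `B_n`: `σ ≤_R ω` iff `ω = σ s_{j_1} ⋯ s_{j_k}` with
`ℓ(ω) = ℓ(σ) + k`. -/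
def BWeakLE (n : ℕ) (σ ω : Equiv.Perm ℤ) : Prop :=
  ∃ l : List (Equiv.Perm ℤ), (∀ s ∈ l, BGen n s) ∧ ω = σ * l.prod ∧
    blen n ω = blen n σ + l.length

/-- The shifted staircase diagram `λ_n^s = {(a,b) ∈ [±n]² : a < b, |a| ≤ b}`. -/
def LamS (n : ℕ) :=
  {p : ℤ × ℤ // p.1 ≠ 0 ∧ -(n : ℤ) ≤ p.1 ∧ p.1 < p.2 ∧ |p.1| ≤ p.2 ∧ p.2 ≤ (n : ℤ)}

/-- Arcs of the shifted valued digraph `ℬ`: from `(a,b)` to each element of the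
shifted hook `H̃(a,b) = {(a,k), (k,b), (-k,-a) : a < k < b} ∩ λ_n^s` other than
`(a,b)` itself. -/
def lamSE {n : ℕ} (p q : LamS n) : Prop :=
  p ≠ q ∧ ∃ k : ℤ, p.1.1 < k ∧ k < p.1.2 ∧
    (q.1 = (p.1.1, k) ∨ q.1 = (k, p.1.2) ∨ q.1 = (-k, -p.1.1))

/-- Valuation of the shifted valued digraph: `θ(c) = d⁺(c) / 2`. -/
noncomputable def lamSTheta {n : ℕ} (p : LamS n) : ℕ :=
  Set.ncard {q : LamS n | lamSE p q} / 2


/-! ### Generalities on peeling -/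

theorem peelFrom_append {V : Type*} (E : V → V → Prop) (θ : V → ℕ) (L : List V) (x : V) :
    ∀ R : Finset V, PeelFrom E θ R L → ErasableAt E θ (R ∪ L.toFinset) x →
      PeelFrom E θ R (L ++ [x]) := by
  induction L with
  | nil =>
    intro R _ h
    simpa [PeelFrom] using h
  | cons y L ih =>
    intro R h hx
    refine ⟨h.1, ih _ h.2 ?_⟩
    have : insert y R ∪ L.toFinset = R ∪ (y :: L).toFinset := by
      ext z; simp
    rwa [this]

theorem initial_insert {V : Type*} {E : V → V → Prop} {θ : V → ℕ} {R : Finset V} {x : V}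
    (h : IsInitialSection E θ R) (hx : ErasableAt E θ R x) :
    IsInitialSection E θ (insert x R) := by
  obtain ⟨L, hL, rfl⟩ := h
  refine ⟨L ++ [x], peelFrom_append E θ L x ∅ hL (by simpa using hx), ?_⟩
  ext z; simp

theorem peel_induct {V : Type*} {E : V → V → Prop} {θ : V → ℕ} {P : Finset V → Prop}
    (hs : ∀ R x, P R → ErasableAt E θ R x → P (insert x R)) (L : List V) :
    ∀ R, P R → PeelFrom E θ R L → P (R ∪ L.toFinset) := by
  induction L with
  | nil => intro R hR _; simpa using hR
  | cons y L ih =>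
    intro R hR h
    have := ih _ (hs R y hR h.1) h.2
    have e : insert y R ∪ L.toFinset = R ∪ (y :: L).toFinset := by
      ext z; simp
    rwa [e] at this

theorem initial_induct {V : Type*} {E : V → V → Prop} {θ : V → ℕ} {P : Finset V → Prop}
    (h0 : P ∅) (hs : ∀ R x, P R → ErasableAt E θ R x → P (insert x R)) {A : Finset V}
    (hA : IsInitialSection E θ A) : P A := by
  obtain ⟨L, hL, rfl⟩ := hA
  simpa using peel_induct hs L ∅ h0 hL

/-- Counting along an involution. -/
theorem involution_count {α : Type*} (S R : Finset α) (f : α → α)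
    (hf : ∀ x ∈ S, f x ∈ S) (hff : ∀ x ∈ S, f (f x) = x) (hne : ∀ x ∈ S, f x ≠ x)
    (hR : ∀ x ∈ S, x ∈ R → f x ∉ R) :
    S.card / 2 - (S.filter (· ∈ R)).card = 0 ↔ ∀ x ∈ S, x ∈ R ∨ f x ∈ R := by
  have hc := Finset.card_filter_add_card_filter_not (s := S) (· ∈ R)
  have hinj : Set.InjOn f S := by
    intro x hx y hy h
    rw [← hff x hx, ← hff y hy, h]
  have hcard : ((S.filter (· ∈ R)).image f).card = (S.filter (· ∈ R)).card := by
    apply Finset.card_image_of_injOn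
    intro x hx y hy h
    simp only [Finset.coe_filter, Set.mem_ofPred_eq] at hx hy
    exact hinj hx.1 hy.1 h
  constructor
  · intro h x hx
    by_contra! hcon
    have hsub : insert x (insert (f x) ((S.filter (· ∈ R)).image f)) ⊆
        S.filter (fun y => ¬ y ∈ R) := by
      intro y hy
      simp only [Finset.mem_insert, Finset.mem_image, Finset.mem_filter] at hy ⊢
      rcases hy with rfl | rfl | ⟨z, hz, rfl⟩
      · exact ⟨hx, hcon.1⟩
      · exact ⟨hf _ hx, hcon.2⟩
      · exact ⟨hf _ hz.1, hR _ hz.1 hz.2⟩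
    have h1 := Finset.card_le_card hsub
    rw [Finset.card_insert_of_notMem, Finset.card_insert_of_notMem, hcard] at h1
    · omega
    · simp only [Finset.mem_image, Finset.mem_filter, not_exists, not_and]
      rintro z ⟨hz, hzR⟩ hzx
      exact hcon.1 (hinj hz hx hzx ▸ hzR)
    · simp only [Finset.mem_insert, Finset.mem_image, Finset.mem_filter, not_or, not_exists,
        not_and]
      refine ⟨fun e => hne x hx e.symm, ?_⟩
      rintro z ⟨hz, hzR⟩ hzx
      apply hcon.2
      rw [← hzx, hff z hz]; exact hzR
  · intro h
    have hsub : S.filter (fun y => ¬ y ∈ R) ⊆ (S.filter (· ∈ R)).image f := by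
      intro y hy
      simp only [Finset.mem_image, Finset.mem_filter] at hy ⊢
      exact ⟨f y, ⟨hf _ hy.1, (h y hy.1).resolve_left hy.2⟩, hff y hy.1⟩
    have h1 := Finset.card_le_card hsub
    omega

/-! ### The shifted staircase -/

instance lamSFinite (n : ℕ) : Finite (LamS n) := by
  have : Set.Finite {p : ℤ × ℤ | p.1 ≠ 0 ∧ -(n : ℤ) ≤ p.1 ∧ p.1 < p.2 ∧ |p.1| ≤ p.2 ∧
      p.2 ≤ (n : ℤ)} := by
    apply Set.Finite.subset (Set.finite_Icc ((-(n : ℤ), -(n : ℤ)) : ℤ × ℤ) (n, n))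
    rintro ⟨a, b⟩ h
    simp only [Set.mem_ofPred_eq] at h
    have := abs_nonneg a
    simp only [Set.mem_Icc, Prod.mk_le_mk]
    omega
  exact this.to_subtype

noncomputable instance lamSFintype (n : ℕ) : Fintype (LamS n) := Fintype.ofFinite _

/-- The condition for a pair to be a box. -/
def Box (n : ℕ) (p : ℤ × ℤ) : Prop :=
  p.1 ≠ 0 ∧ -(n : ℤ) ≤ p.1 ∧ p.1 < p.2 ∧ |p.1| ≤ p.2 ∧ p.2 ≤ (n : ℤ)

/-- The box with given entries. -/
def mkL {n : ℕ} (p : ℤ × ℤ) (h : Box n p) : LamS n := ⟨p, h⟩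

theorem mkL_val {n : ℕ} (p : ℤ × ℤ) (h : Box n p) : (mkL p h).1 = p := rfl

/-- the normal form of a pair `(a,k)` -/
def nrm (a k : ℤ) : ℤ × ℤ := if |a| ≤ k then (a, k) else (-k, -a)

/-- the pairing on the hook of `(a,b)` -/
def phi (a b : ℤ) (q : ℤ × ℤ) : ℤ × ℤ :=
  if q.2 = b then nrm a q.1 else if q.1 = a then (q.2, b) else (-q.1, b)

/-- the pairing on boxes -/
noncomputable def phiL {n : ℕ} (z q : LamS n) : LamS n :=
  if h : Box n (phi z.1.1 z.1.2 q.1) then ⟨phi z.1.1 z.1.2 q.1, h⟩ else q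

theorem phiL_val {n : ℕ} (z q : LamS n) (h : Box n (phi z.1.1 z.1.2 q.1)) :
    (phiL z q).1 = phi z.1.1 z.1.2 q.1 := by
  exact congrArg Subtype.val (dif_pos h)

theorem hook_pair {n : ℕ} (z q : LamS n) (h : lamSE z q) :
    ∃ k : ℤ, k ≠ 0 ∧ z.1.1 < k ∧ k < z.1.2 ∧
      ((q.1 = (k, z.1.2) ∧ phi z.1.1 z.1.2 q.1 = nrm z.1.1 k) ∨
       (q.1 = nrm z.1.1 k ∧ phi z.1.1 z.1.2 q.1 = (k, z.1.2))) := by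
  obtain ⟨⟨a, b⟩, hz⟩ := z
  obtain ⟨⟨c, d⟩, hq⟩ := q
  obtain ⟨hne, k, h1, h2, h⟩ := h
  have hne' : ¬ (a = c ∧ b = d) := by
    rintro ⟨rfl, rfl⟩; exact hne rfl
  simp only [Prod.mk.injEq] at *
  rcases h with ⟨rfl, rfl⟩ | ⟨rfl, rfl⟩ | ⟨rfl, rfl⟩
  · refine ⟨d, by grind, h1, h2, Or.inr ⟨?_, ?_⟩⟩
    · simp [nrm, hq.2.2.2.1]
    · simp [phi]; intro; omega
  · exact ⟨c, hq.1, h1, h2, Or.inl ⟨⟨rfl, rfl⟩, by simp [phi]⟩⟩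
  · by_cases hb : -a = b
    · refine ⟨-k, by omega, by omega, by omega, Or.inl ⟨⟨rfl, hb⟩, by simp [phi, hb]⟩⟩
    · refine ⟨k, by omega, h1, h2, Or.inr ⟨?_, ?_⟩⟩
      · simp only [nrm]; split_ifs with h3
        · simp only [Prod.mk.injEq]; grind
        · rfl
      · simp only [phi, if_neg hb]
        split_ifs with h4
        · simp; omega
        · simp

theorem nrm_box {n : ℕ} {a b k : ℤ} (h : Box n (a, b)) (hk : k ≠ 0) (h1 : a < k) (h2 : k < b) :
    Box n (nrm a k) := by
  unfold Box nrm at *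
  split_ifs <;> grind

theorem snd_box {n : ℕ} {a b k : ℤ} (h : Box n (a, b)) (hk : k ≠ 0) (h1 : a < k) (h2 : k < b) :
    Box n (k, b) := by
  unfold Box at *
  grind

theorem lamSE_snd {n : ℕ} (z q : LamS n) (k : ℤ) (h1 : z.1.1 < k) (h2 : k < z.1.2)
    (hq : q.1 = (k, z.1.2)) : lamSE z q := by
  refine ⟨?_, k, h1, h2, Or.inr (Or.inl hq)⟩
  rintro rfl
  have := congrArg Prod.fst hq
  simp at this; omega

theorem lamSE_nrm {n : ℕ} (z q : LamS n) (k : ℤ) (h1 : z.1.1 < k) (h2 : k < z.1.2)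
    (hq : q.1 = nrm z.1.1 k) : lamSE z q := by
  unfold nrm at hq
  refine ⟨?_, k, h1, h2, ?_⟩
  · rintro rfl
    split_ifs at hq
    · have := congrArg Prod.snd hq
      simp at this; omega
    · have e1 := congrArg Prod.fst hq
      have e2 := congrArg Prod.snd hq
      simp at e1 e2; omega
  · split_ifs at hq <;> simp [hq]

theorem phi_snd {a b k : ℤ} : phi a b (k, b) = nrm a k := by simp [phi]

theorem phi_nrm {n : ℕ} {a b k : ℤ} (h : Box n (a, b)) (h1 : a < k) (h2 : k < b) :
    phi a b (nrm a k) = (k, b) := by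
  unfold Box phi nrm at *
  split_ifs <;> grind

theorem nrm_ne {a b k : ℤ} (h2 : k < b) (hk : k ≠ 0) : nrm a k ≠ (k, b) := by
  unfold nrm; split_ifs <;> simp <;> omega

/-! ### Signed permutations -/

theorem IsSigned.inv_neg {n : ℕ} {ω : Equiv.Perm ℤ} (h : IsSigned n ω) (m : ℤ) :
    ω⁻¹ (-m) = -ω⁻¹ m := by
  apply ω.injective
  rw [h.1]; simp

theorem IsSigned.zero {n : ℕ} {ω : Equiv.Perm ℤ} (h : IsSigned n ω) : ω 0 = 0 := by
  have := h.1 0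
  simp at this; omega

theorem IsSigned.inv {n : ℕ} {ω : Equiv.Perm ℤ} (h : IsSigned n ω) : IsSigned n ω⁻¹ := by
  refine ⟨h.inv_neg, fun m hm => ?_⟩
  apply ω.injective
  rw [h.2 m hm]; simp

theorem IsSigned.mul {n : ℕ} {ω σ : Equiv.Perm ℤ} (h : IsSigned n ω) (h' : IsSigned n σ) :
    IsSigned n (ω * σ) := by
  refine ⟨fun m => ?_, fun m hm => ?_⟩
  · simp [h.1, h'.1]
  · simp [h.2 m hm, h'.2 m hm]

theorem IsSigned.one (n : ℕ) : IsSigned n 1 := by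
  constructor <;> simp

theorem IsSigned.ne_zero {n : ℕ} {ω : Equiv.Perm ℤ} (h : IsSigned n ω) {m : ℤ} (hm : m ≠ 0) :
    ω m ≠ 0 := by
  intro e
  exact hm (ω.injective (e.trans h.zero.symm))

theorem IsSigned.abs_le {n : ℕ} {ω : Equiv.Perm ℤ} (h : IsSigned n ω) {m : ℤ} (hm : |m| ≤ n) :
    |ω m| ≤ n := by
  by_contra! hc
  have := ω.injective (h.2 _ hc)
  rw [this] at hc; omega

/-- The inversion set as a finset of boxes. -/
noncomputable def Iv (n : ℕ) (ω : Equiv.Perm ℤ) : Finset (LamS n) :=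
  Finset.univ.filter fun v => ω⁻¹ v.1.2 < ω⁻¹ v.1.1

theorem mem_Iv {n : ℕ} {ω : Equiv.Perm ℤ} {v : LamS n} :
    v ∈ Iv n ω ↔ ω⁻¹ v.1.2 < ω⁻¹ v.1.1 := by
  simp [Iv]

theorem Iv_coe (n : ℕ) (ω : Equiv.Perm ℤ) :
    (Iv n ω : Set (LamS n)) = {v : LamS n | (v.1.1, v.1.2) ∈ InvBSet n ω} := by
  ext v
  have h := v.2
  have h' : v.1.2 ≠ 0 := by
    have := abs_pos.mpr h.1
    have := h.2.2.2.1
    omega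
  simp only [Finset.mem_coe, mem_Iv]
  constructor
  · intro hv
    exact ⟨h.1, h', h.2.1, h.2.2.2.2, h.2.2.1, h.2.2.2.1, hv⟩
  · intro hv
    exact hv.2.2.2.2.2.2

theorem mem_Iv_nrm {n : ℕ} {ω : Equiv.Perm ℤ} (h : IsSigned n ω) {v : LamS n} {a k : ℤ}
    (hv : v.1 = nrm a k) : v ∈ Iv n ω ↔ ω⁻¹ k < ω⁻¹ a := by
  rw [mem_Iv, hv]
  unfold nrm
  split_ifs
  · rfl
  · simp only [h.inv_neg]; omega

theorem mem_Iv_mk {n : ℕ} {ω : Equiv.Perm ℤ} {v : LamS n} {a k : ℤ}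
    (hv : v.1 = (a, k)) : v ∈ Iv n ω ↔ ω⁻¹ k < ω⁻¹ a := by
  rw [mem_Iv, hv]

theorem curVal_eq_zero_iff {n : ℕ} {ω : Equiv.Perm ℤ} (h : IsSigned n ω) (z : LamS n)
    (hz : z ∉ Iv n ω) :
    curVal lamSE lamSTheta (Iv n ω) z = 0 ↔
      ∀ k : ℤ, k ≠ 0 → z.1.1 < k → k < z.1.2 → ¬ (ω⁻¹ z.1.1 < ω⁻¹ k ∧ ω⁻¹ k < ω⁻¹ z.1.2) := by
  have hzB : Box n (z.1.1, z.1.2) := z.2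
  have hlt : ω⁻¹ z.1.1 < ω⁻¹ z.1.2 := by
    rw [mem_Iv] at hz
    have : ω⁻¹ z.1.1 ≠ ω⁻¹ z.1.2 := fun e => by
      have := (ω⁻¹).injective e
      have := z.2.2.2.1
      omega
    omega
  -- the facts about the pairing
  have key : ∀ q, lamSE z q → ∃ k : ℤ, k ≠ 0 ∧ z.1.1 < k ∧ k < z.1.2 ∧
      lamSE z (phiL z q) ∧ phiL z (phiL z q) = q ∧ phiL z q ≠ q ∧
      ((q ∈ Iv n ω ↔ ω⁻¹ z.1.2 < ω⁻¹ k) ∧ (phiL z q ∈ Iv n ω ↔ ω⁻¹ k < ω⁻¹ z.1.1) ∨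
       (phiL z q ∈ Iv n ω ↔ ω⁻¹ z.1.2 < ω⁻¹ k) ∧ (q ∈ Iv n ω ↔ ω⁻¹ k < ω⁻¹ z.1.1)) := by
    intro q hq
    obtain ⟨k, hk, h1, h2, h3⟩ := hook_pair z q hq
    have b1 := nrm_box hzB hk h1 h2
    have b2 := snd_box hzB hk h1 h2
    refine ⟨k, hk, h1, h2, ?_⟩
    rcases h3 with ⟨e1, e2⟩ | ⟨e1, e2⟩
    · have e3 : (phiL z q).1 = nrm z.1.1 k := by rw [phiL_val _ _ (e2 ▸ b1), e2]
      have e4 : phi z.1.1 z.1.2 (phiL z q).1 = (k, z.1.2) := by rw [e3]; exact phi_nrm hzB h1 h2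
      refine ⟨lamSE_nrm z _ k h1 h2 e3, ?_, ?_, Or.inl ⟨mem_Iv_mk e1, mem_Iv_nrm h e3⟩⟩
      · apply Subtype.ext
        exact (phiL_val _ _ (e4 ▸ b2)).trans (e4.trans e1.symm)
      · intro e
        exact nrm_ne h2 hk (e3.symm.trans ((congrArg Subtype.val e).trans e1))
    · have e3 : (phiL z q).1 = (k, z.1.2) := by rw [phiL_val _ _ (e2 ▸ b2), e2]
      have e4 : phi z.1.1 z.1.2 (phiL z q).1 = nrm z.1.1 k := by rw [e3]; exact phi_snd
      refine ⟨lamSE_snd z _ k h1 h2 e3, ?_, ?_, Or.inr ⟨mem_Iv_mk e3, mem_Iv_nrm h e1⟩⟩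
      · apply Subtype.ext
        exact (phiL_val _ _ (e4 ▸ b1)).trans (e4.trans e1.symm)
      · intro e
        exact nrm_ne h2 hk (e1.symm.trans ((congrArg Subtype.val e).symm.trans e3))
  have hcount := involution_count (Finset.univ.filter fun q => lamSE z q) (Iv n ω) (phiL z)
    (by
      intro q hq
      obtain ⟨k, -, -, -, hE, -⟩ := key q (by simpa using hq)
      simpa using hE)
    (by
      intro q hq
      obtain ⟨k, -, -, -, -, hE, -⟩ := key q (by simpa using hq)
      exact hE)
    (by
      intro q hq
      obtain ⟨k, -, -, -, -, -, hE, -⟩ := key q (by simpa using hq)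
      exact hE)
    (by
      intro q hq
      obtain ⟨k, -, -, -, -, -, -, hE⟩ := key q (by simpa using hq)
      rcases hE with ⟨ha, hb⟩ | ⟨ha, hb⟩ <;> rw [ha, hb] <;> omega)
  have e1 : lamSTheta z = (Finset.univ.filter fun q => lamSE z q).card / 2 := by
    unfold lamSTheta
    rw [← Set.ncard_coe_finset]
    simp
  have e2 : (Iv n ω).filter (fun q => lamSE z q) =
      (Finset.univ.filter fun q => lamSE z q).filter (· ∈ Iv n ω) := by
    ext q; simp [and_comm]
  unfold curVal
  rw [e1, e2, hcount]
  constructor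
  · intro H k hk h1 h2 hcon
    have b2 := snd_box hzB hk h1 h2
    have hE := lamSE_snd z (mkL (k, z.1.2) b2) k h1 h2 rfl
    have b1 := nrm_box hzB hk h1 h2
    have e3 : (phiL z (mkL (k, z.1.2) b2)).1 = nrm z.1.1 k := by
      have e4 : phi z.1.1 z.1.2 (k, z.1.2) = nrm z.1.1 k := phi_snd
      exact (phiL_val z (mkL (k, z.1.2) b2) (e4 ▸ b1)).trans e4
    have := H (mkL (k, z.1.2) b2) (by simpa using hE)
    rw [mem_Iv_nrm h e3, mem_Iv_mk (mkL_val _ _)] at this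
    omega
  · intro H q hq
    obtain ⟨k, hk, h1, h2, -, -, -, hE⟩ := key q (by simpa using hq)
    have n1 : ω⁻¹ z.1.1 ≠ ω⁻¹ k := fun e => by
      have := (ω⁻¹).injective e
      omega
    have n2 : ω⁻¹ z.1.2 ≠ ω⁻¹ k := fun e => by
      have := (ω⁻¹).injective e
      omega
    have := H k hk h1 h2
    rcases hE with ⟨ha, hb⟩ | ⟨ha, hb⟩ <;> rw [ha, hb] <;> omega

/-- Adjacency in position of the two entries of a box. -/
def AdjPos (n : ℕ) (ω : Equiv.Perm ℤ) (z : LamS n) : Prop :=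
  ω⁻¹ z.1.1 < ω⁻¹ z.1.2 ∧ ∀ m : ℤ, ω⁻¹ z.1.1 < m → m < ω⁻¹ z.1.2 → m = 0

theorem not_mem_lt {n : ℕ} {ω : Equiv.Perm ℤ} (z : LamS n)
    (hz : z ∉ Iv n ω) : ω⁻¹ z.1.1 < ω⁻¹ z.1.2 := by
  rw [mem_Iv] at hz
  have : ω⁻¹ z.1.1 ≠ ω⁻¹ z.1.2 := fun e => by
    have := (ω⁻¹).injective e
    have := z.2.2.2.1
    omega
  omega

theorem erasable_of_adj {n : ℕ} {ω : Equiv.Perm ℤ} (h : IsSigned n ω) (x : LamS n)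
    (hx : AdjPos n ω x) : ErasableAt lamSE lamSTheta (Iv n ω) x := by
  obtain ⟨hlt, hadj⟩ := hx
  have hxn : x ∉ Iv n ω := by rw [mem_Iv]; omega
  refine ⟨hxn, ?_, ?_⟩
  · rw [curVal_eq_zero_iff h x hxn]
    intro k hk _ _ hc
    exact h.inv.ne_zero hk (hadj _ hc.1 hc.2)
  · intro z hz hE
    rw [Ne, curVal_eq_zero_iff h z hz]
    intro H
    have hzlt := not_mem_lt z hz
    obtain ⟨hne, k, h1, h2, hE⟩ := hE
    have hz0 : z.1.1 ≠ 0 := z.2.1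
    have hz2 : z.1.2 ≠ 0 := by have := z.2.2.2.2.1; have := abs_pos.mpr hz0; omega
    have i1 := h.inv.ne_zero hz0
    have i2 := h.inv.ne_zero hz2
    have hk : k ≠ 0 := by
      have g1 : x.1.1 ≠ 0 := x.2.1
      have g2 : x.1.2 ≠ 0 := by have := x.2.2.2.2.1; have := abs_pos.mpr g1; omega
      rcases hE with e | e | e <;> rw [e] at g1 g2 <;> simp at g1 g2 <;> omega
    have n2 : ω⁻¹ z.1.2 ≠ ω⁻¹ k := fun e => by
      have := (ω⁻¹).injective e
      omega
    have n1 : ω⁻¹ z.1.1 ≠ ω⁻¹ k := fun e => by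
      have := (ω⁻¹).injective e
      omega
    apply H k hk h1 h2
    rcases hE with e | e | e <;> rw [e] at hlt hadj <;> simp only at hlt hadj
    · refine ⟨hlt, ?_⟩
      by_contra hc
      exact i2 (hadj _ hzlt (by omega))
    · refine ⟨?_, hlt⟩
      by_contra hc
      exact i1 (hadj _ (by omega) hzlt)
    · rw [h.inv_neg, h.inv_neg] at hlt hadj
      refine ⟨by omega, ?_⟩
      by_contra hc
      have := hadj (-ω⁻¹ z.1.2) (by omega) (by omega)
      omega

theorem adj_of_erasable {n : ℕ} {ω : Equiv.Perm ℤ} (h : IsSigned n ω) (x : LamS n)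
    (hx : ErasableAt lamSE lamSTheta (Iv n ω) x) : AdjPos n ω x := by
  obtain ⟨hxn, h0, hE⟩ := hx
  rw [curVal_eq_zero_iff h x hxn] at h0
  have hlt := not_mem_lt x hxn
  refine ⟨hlt, ?_⟩
  by_contra! hcon
  obtain ⟨m, hm1, hm2, hm0⟩ := hcon
  have hxB : Box n x.1 := x.2
  obtain ⟨hx1, hx2, hx3, hx4, hx5⟩ := hxB
  have hxv : x.1 = (x.1.1, x.1.2) := rfl
  generalize x.1.1 = a at *
  generalize x.1.2 = b at *
  have hab := abs_le.mp hx4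
  have hm : |m| ≤ n := by
    have g1 := h.inv.abs_le (m := a) (by omega)
    have g2 := h.inv.abs_le (m := b) (by rw [abs_le]; omega)
    rw [abs_le] at *
    omega
  have hc := h.abs_le hm
  have hc0 := h.ne_zero hm0
  have hcm : ω⁻¹ (ω m) = m := by simp
  generalize ω m = c at hc hc0 hcm
  subst hcm
  rw [abs_le] at hc
  have hca : c ≠ a := by rintro rfl; omega
  have hcb : c ≠ b := by rintro rfl; omega
  have hout : c < a ∨ b < c := by
    by_contra! hh
    exact h0 c hc0 (by omega) (by omega) ⟨hm1, hm2⟩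
  rcases hout with hlo | hhi
  · -- the largest such `c`
    obtain ⟨c, ⟨hc0, hc1, hc2, hc3, hc4⟩, hmax⟩ := Int.exists_greatest_of_bdd
      (P := fun c => c ≠ 0 ∧ -(n:ℤ) ≤ c ∧ c < a ∧ ω⁻¹ a < ω⁻¹ c ∧ ω⁻¹ c < ω⁻¹ b)
      ⟨a, fun z hz => by omega⟩ ⟨c, hc0, hc.1, hlo, hm1, hm2⟩
    have hno : ∀ k, k ≠ 0 → c < k → k < b → ¬ (ω⁻¹ c < ω⁻¹ k ∧ ω⁻¹ k < ω⁻¹ b) := by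
      intro k hk h1 h2 ⟨h3, h4⟩
      rcases lt_trichotomy k a with g | g | g
      · have := hmax k ⟨hk, by omega, g, by omega, h4⟩; omega
      · subst g; omega
      · exact h0 k hk g h2 ⟨by omega, h4⟩
    by_cases hcb : -b ≤ c
    · have hB : Box n (c, b) := ⟨hc0, hc1, by simp only; omega, by simp only [abs_le]; omega, hx5⟩
      have hz : mkL (c, b) hB ∉ Iv n ω := by
        rw [mem_Iv_mk (mkL_val _ _)]; omega
      refine hE (mkL (c, b) hB) hz ?_ ?_
      · refine ⟨?_, a, by simp only [mkL_val]; omega, by simp only [mkL_val]; omega, Or.inr (Or.inl hxv)⟩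
        intro e
        have := congrArg (fun v : LamS n => v.1.1) e
        simp only [mkL_val, hxv] at this; omega
      · rw [curVal_eq_zero_iff h _ hz]
        exact hno
    · have hB : Box n (-b, -c) := ⟨by simp only; omega, by simp only; omega, by simp only; omega,
        by simp only [abs_le]; omega, by simp only; omega⟩
      have hz : mkL (-b, -c) hB ∉ Iv n ω := by
        rw [mem_Iv_mk (mkL_val _ _), h.inv_neg, h.inv_neg]; omega
      refine hE (mkL (-b, -c) hB) hz ?_ ?_
      · refine ⟨?_, -a, by simp only [mkL_val]; omega, by simp only [mkL_val]; omega, Or.inr (Or.inr (by simp [hxv, mkL_val]))⟩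
        intro e
        have := congrArg (fun v : LamS n => v.1.2) e
        simp only [mkL_val, hxv] at this; omega
      · rw [curVal_eq_zero_iff h _ hz]
        intro k hk h1 h2 h3
        simp only [mkL_val, h.inv_neg] at h1 h2 h3
        apply hno (-k) (by omega) (by omega) (by omega)
        rw [h.inv_neg]; omega
  · obtain ⟨c, ⟨hc0, hc1, hc2, hc3, hc4⟩, hmin⟩ := Int.exists_least_of_bdd
      (P := fun c => c ≠ 0 ∧ c ≤ (n : ℤ) ∧ b < c ∧ ω⁻¹ a < ω⁻¹ c ∧ ω⁻¹ c < ω⁻¹ b)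
      ⟨b, fun z hz => by omega⟩ ⟨c, hc0, hc.2, hhi, hm1, hm2⟩
    have hB : Box n (a, c) := ⟨hx1, hx2, by simp only; omega, by simp only; omega, hc1⟩
    have hz : mkL (a, c) hB ∉ Iv n ω := by
      rw [mem_Iv_mk (mkL_val _ _)]; omega
    refine hE (mkL (a, c) hB) hz ?_ ?_
    · refine ⟨?_, b, by simp only [mkL_val]; omega, by simp only [mkL_val]; omega, Or.inl hxv⟩
      intro e
      have := congrArg (fun v : LamS n => v.1.2) e
      simp only [mkL_val, hxv] at this; omega
    · rw [curVal_eq_zero_iff h _ hz]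
      intro k hk h1 h2 ⟨h3, h4⟩
      simp only [mkL_val] at h1 h2 h3 h4
      rcases lt_trichotomy k b with g | g | g
      · exact h0 k hk h1 g ⟨h3, by omega⟩
      · subst g; omega
      · have := hmin k ⟨hk, by omega, g, h3, by omega⟩; omega

/-! ### Generators -/

/-- `s` exchanges the two adjacent positions `p, q` (and `-p, -q`). -/
def AdjRefl (n : ℕ) (s : Equiv.Perm ℤ) (p q : ℤ) : Prop :=
  p ≠ 0 ∧ q ≠ 0 ∧ p < q ∧ (∀ m, p < m → m < q → m = 0) ∧ -(n : ℤ) ≤ p ∧ q ≤ (n : ℤ) ∧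
    ∀ m, s m = if m = p then q else if m = q then p else if m = -p then -q
      else if m = -q then -p else m

theorem AdjRefl.neg {n : ℕ} {s : Equiv.Perm ℤ} {p q : ℤ} (h : AdjRefl n s p q) :
    AdjRefl n s (-q) (-p) := by
  obtain ⟨h1, h2, h3, h4, h5, h6, h7⟩ := h
  refine ⟨by omega, by omega, by omega, fun m a b => ?_, by omega, by omega, fun m => ?_⟩
  · have := h4 (-m) (by omega) (by omega); omega
  · rw [h7]; split_ifs <;> omega

theorem adj_cases {p q : ℤ} (hp : p ≠ 0) (hq : q ≠ 0) (h : p < q)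
    (h4 : ∀ m, p < m → m < q → m = 0) : q = p + 1 ∨ (p = -1 ∧ q = 1) := by
  by_contra! hc
  have h1 := h4 (p + 1) (by omega) (by omega)
  have h2 := h4 (q - 1) (by omega) (by omega)
  omega

theorem isRefl_zero {n : ℕ} (hn : 1 ≤ n) : AdjRefl n (Equiv.swap (1 : ℤ) (-1)) (-1) 1 := by
  refine ⟨by omega, by omega, by omega, fun m a b => by omega, by omega, by omega, fun m => ?_⟩
  rw [Equiv.swap_apply_def]
  split_ifs <;> omega

theorem isRefl_succ {n i : ℕ} (hi : 1 ≤ i) (hn : i < n) :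
    AdjRefl n (Equiv.swap (i : ℤ) ((i : ℤ) + 1) * Equiv.swap (-(i : ℤ)) (-((i : ℤ) + 1)))
      i (i + 1) := by
  refine ⟨by omega, by omega, by omega, fun m a b => by omega, by omega, by omega, fun m => ?_⟩
  rw [Equiv.Perm.mul_apply, Equiv.swap_apply_def, Equiv.swap_apply_def]
  split_ifs <;> omega

theorem BGen.isRefl {n : ℕ} (hn : 1 ≤ n) {s : Equiv.Perm ℤ} (h : BGen n s) :
    ∃ p q, AdjRefl n s p q := by
  rcases h with rfl | ⟨i, h1, h2, rfl⟩
  · exact ⟨_, _, isRefl_zero hn⟩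
  · exact ⟨_, _, isRefl_succ h1 h2⟩

theorem exists_gen {n : ℕ} {p q : ℤ} (hp : p ≠ 0) (hq : q ≠ 0) (h : p < q)
    (h4 : ∀ m, p < m → m < q → m = 0) (hpn : -(n : ℤ) ≤ p) (hqn : q ≤ (n : ℤ)) :
    ∃ s, BGen n s ∧ AdjRefl n s p q := by
  rcases adj_cases hp hq h h4 with rfl | ⟨rfl, rfl⟩
  · rcases lt_or_gt_of_ne hp with hlt | hgt
    · have hb : p + 1 = -((-(p + 1)).toNat : ℤ) := by omega
      have ha : p = -((-(p + 1)).toNat + 1 : ℤ) := by omega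
      have h1 : 1 ≤ (-(p + 1)).toNat := by omega
      have h2 : (-(p + 1)).toNat < n := by omega
      refine ⟨_, Or.inr ⟨_, h1, h2, rfl⟩, ?_⟩
      have := (isRefl_succ h1 h2).neg
      rwa [← hb, ← ha] at this ⊢
    · have ha : ((p.toNat : ℕ) : ℤ) = p := by omega
      have h1 : 1 ≤ p.toNat := by omega
      have h2 : p.toNat < n := by omega
      refine ⟨_, Or.inr ⟨_, h1, h2, rfl⟩, ?_⟩
      have := isRefl_succ h1 h2
      rwa [ha] at this ⊢
  · exact ⟨_, Or.inl rfl, isRefl_zero (by omega)⟩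

theorem AdjRefl.isSigned {n : ℕ} {s : Equiv.Perm ℤ} {p q : ℤ} (h : AdjRefl n s p q) :
    IsSigned n s := by
  obtain ⟨h1, h2, h3, h4, h5, h6, h7⟩ := h
  refine ⟨fun m => ?_, fun m hm => ?_⟩
  · rw [h7, h7]; split_ifs <;> omega
  · rw [h7]; rw [lt_abs] at hm; split_ifs <;> omega

theorem AdjRefl.sq {n : ℕ} {s : Equiv.Perm ℤ} {p q : ℤ} (h : AdjRefl n s p q) : s * s = 1 := by
  obtain ⟨h1, h2, h3, h4, h5, h6, h7⟩ := h
  ext m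
  rw [Equiv.Perm.mul_apply, Equiv.Perm.one_apply, h7 (s m), h7 m]
  split_ifs <;> omega

theorem AdjRefl.lt_iff {n : ℕ} {s : Equiv.Perm ℤ} {p q : ℤ} (h : AdjRefl n s p q) {u v : ℤ}
    (hu : u ≠ 0) (hv : v ≠ 0) (huv : u ≠ v) :
    s u < s v ↔ (u < v ∧ ¬ (u = p ∧ v = q) ∧ ¬ (u = -q ∧ v = -p)) ∨ (u = q ∧ v = p) ∨
      (u = -p ∧ v = -q) := by
  obtain ⟨h1, h2, h3, h4, h5, h6, h7⟩ := h
  have hc := adj_cases h1 h2 h3 h4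
  rw [h7, h7]
  clear h7 h4
  split_ifs <;> omega

theorem step_insert {n : ℕ} {σ s : Equiv.Perm ℤ} (h : IsSigned n σ) {p q : ℤ}
    (hs : AdjRefl n s p q) (hlt : σ p < σ q) (habs : |σ p| ≤ σ q) :
    ∃ x : LamS n, x.1 = (σ p, σ q) ∧ AdjPos n σ x ∧ x ∉ Iv n σ ∧
      Iv n (σ * s) = insert x (Iv n σ) := by
  have hs' := hs
  obtain ⟨h1, h2, h3, h4, h5, h6, h7⟩ := hs'
  have a1 := h.abs_le (m := p) (by rw [abs_le]; omega)
  have a2 := h.abs_le (m := q) (by rw [abs_le]; omega)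
  have a3 := h.ne_zero h1
  rw [abs_le] at a1 a2
  have hB : Box n (σ p, σ q) := ⟨a3, a1.1, hlt, habs, a2.2⟩
  have e1 : σ⁻¹ (σ p) = p := by simp
  have e2 : σ⁻¹ (σ q) = q := by simp
  have hnot : mkL _ hB ∉ Iv n σ := by
    rw [mem_Iv_mk (mkL_val _ _), e1, e2]; omega
  refine ⟨mkL _ hB, rfl, ⟨?_, ?_⟩, hnot, ?_⟩
  · simp only [mkL_val, e1, e2]; exact h3
  · simp only [mkL_val, e1, e2]; exact h4
  · ext v
    rw [Finset.mem_insert, mem_Iv, mem_Iv]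
    have hsi : s⁻¹ = s := inv_eq_of_mul_eq_one_left hs.sq
    have hvB : Box n (v.1.1, v.1.2) := v.2
    have hve : v = mkL _ hB ↔ v.1.1 = σ p ∧ v.1.2 = σ q := by
      constructor
      · rintro rfl; exact ⟨rfl, rfl⟩
      · rintro ⟨g1, g2⟩
        exact Subtype.ext (Prod.ext g1 g2)
    rw [hve]
    simp only [mul_inv_rev, hsi, Equiv.Perm.mul_apply]
    generalize v.1.1 = c at *
    generalize v.1.2 = d at *
    obtain ⟨hv1, hv2, hv3, hv4, hv5⟩ := hvB
    simp only at hv1 hv2 hv3 hv4 hv5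
    have hd0 : d ≠ 0 := by have := abs_pos.mpr hv1; omega
    have hne : σ⁻¹ d ≠ σ⁻¹ c := fun e => by
      have := (σ⁻¹).injective e
      omega
    rw [hs.lt_iff (h.inv.ne_zero hd0) (h.inv.ne_zero hv1) hne]
    have tr : ∀ u w, σ⁻¹ u = w ↔ u = σ w := fun u w => Equiv.Perm.inv_eq_iff_eq
    simp only [tr, h.1]
    rw [abs_le] at hv4 habs
    have f1 : c = σ p ∧ d = σ q → ¬ σ⁻¹ d < σ⁻¹ c := by
      rintro ⟨rfl, rfl⟩; rw [e1, e2]; omega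
    omega

theorem step_cases {n : ℕ} {σ s : Equiv.Perm ℤ} (h : IsSigned n σ) {p q : ℤ}
    (hs : AdjRefl n s p q) (hlt : σ p < σ q) :
    ∃ x : LamS n, AdjPos n σ x ∧ x ∉ Iv n σ ∧ Iv n (σ * s) = insert x (Iv n σ) ∧
      (x.1 = (σ p, σ q) ∨ x.1 = (-σ q, -σ p)) := by
  by_cases habs : |σ p| ≤ σ q
  · obtain ⟨x, a, b, c, d⟩ := step_insert h hs hlt habs
    exact ⟨x, b, c, d, Or.inl a⟩
  · have : |σ (-q)| ≤ σ (-p) := by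
      rw [h.1, h.1, abs_neg, abs_le]
      rw [abs_le] at habs
      omega
    obtain ⟨x, a, b, c, d⟩ := step_insert h hs.neg (by rw [h.1, h.1]; omega) this
    rw [h.1, h.1] at a
    exact ⟨x, b, c, d, Or.inr a⟩

theorem step_card {n : ℕ} {σ s : Equiv.Perm ℤ} (h : IsSigned n σ) {p q : ℤ}
    (hs : AdjRefl n s p q) :
    (Iv n (σ * s)).card ≤ (Iv n σ).card + 1 ∧
      ((Iv n (σ * s)).card = (Iv n σ).card + 1 → Iv n σ ⊆ Iv n (σ * s)) := by
  have hpq : p ≠ q := by have := hs.2.2.1; omega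
  have hne : σ p ≠ σ q := fun e => hpq (σ.injective e)
  rcases lt_or_gt_of_ne hne with hlt | hgt
  · obtain ⟨x, -, hx, he, -⟩ := step_cases h hs hlt
    rw [he, Finset.card_insert_of_notMem hx]
    exact ⟨le_rfl, fun _ => Finset.subset_insert _ _⟩
  · have g1 : s p = q := by rw [hs.2.2.2.2.2.2]; simp
    have g2 : s q = p := by rw [hs.2.2.2.2.2.2]; simp [hpq.symm]
    obtain ⟨x, -, hx, he, -⟩ := step_cases (h.mul hs.isSigned) hs (by simp [g1, g2]; omega)
    rw [mul_assoc, hs.sq, mul_one] at he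
    rw [he, Finset.card_insert_of_notMem hx]
    exact ⟨by omega, fun _ => by omega⟩

theorem word_card {n : ℕ} (hn : 1 ≤ n) (l : List (Equiv.Perm ℤ)) :
    ∀ σ : Equiv.Perm ℤ, IsSigned n σ → (∀ s ∈ l, BGen n s) →
      (Iv n (σ * l.prod)).card ≤ (Iv n σ).card + l.length ∧
      ((Iv n (σ * l.prod)).card = (Iv n σ).card + l.length → Iv n σ ⊆ Iv n (σ * l.prod)) := by
  induction l with
  | nil => intro σ _ _; simp
  | cons s l ih =>
    intro σ h hl
    obtain ⟨p, q, hs⟩ := (hl s (by simp)).isRefl hn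
    have h1 := step_card h hs
    have h2 := ih (σ * s) (h.mul hs.isSigned) (fun t ht => hl t (by simp [ht]))
    rw [List.prod_cons, ← mul_assoc, List.length_cons]
    refine ⟨by omega, fun e => ?_⟩
    exact (h1.2 (by omega)).trans (h2.2 (by omega))

theorem perm_eq_one_of_strictMono (g : Equiv.Perm ℤ) (h0 : g 0 = 0) (h : StrictMono g) :
    g = 1 := by
  have hge : ∀ (f : Equiv.Perm ℤ), f 0 = 0 → StrictMono f → ∀ m : ℕ, (m : ℤ) ≤ f m := by
    intro f f0 hf m
    induction m with
    | zero => simp [f0]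
    | succ k ih =>
      have := hf (show (k : ℤ) < (k + 1 : ℕ) by omega)
      omega
  have hle : ∀ (f : Equiv.Perm ℤ), f 0 = 0 → StrictMono f → ∀ m : ℕ, f (-(m : ℤ)) ≤ -m := by
    intro f f0 hf m
    induction m with
    | zero => simp [f0]
    | succ k ih =>
      have := hf (show (-((k + 1 : ℕ) : ℤ)) < -(k : ℤ) by omega)
      omega
  have hi : StrictMono (g⁻¹ : Equiv.Perm ℤ) := by
    intro a b hab
    rw [← h.lt_iff_lt]; simpa using hab
  have hi0 : g⁻¹ 0 = 0 := by
    apply g.injective; simp [h0]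
  ext m
  rw [Equiv.Perm.one_apply]
  rcases Int.eq_nat_or_neg m with ⟨k, rfl | rfl⟩
  · have a := hge g h0 h k
    have b := h.monotone (hge g⁻¹ hi0 hi k)
    simp at b
    omega
  · have a := hle g h0 h k
    have b := h.monotone (hle g⁻¹ hi0 hi k)
    simp at b
    omega

theorem signed_eq_one {n : ℕ} {g : Equiv.Perm ℤ} (hg : IsSigned n g)
    (h : ∀ s p q, BGen n s → AdjRefl n s p q → g p < g q) : g = 1 := by
  apply perm_eq_one_of_strictMono g hg.zero
  have hpos : ∀ m : ℤ, 0 ≤ m → g m < g (m + 1) := by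
    intro m hm
    by_cases hmn : m + 1 ≤ n
    · rcases hm.eq_or_lt with rfl | hm
      · obtain ⟨s, hs, hr⟩ := exists_gen (n := n) (p := -1) (q := 1) (by omega) (by omega)
          (by omega) (fun m _ _ => by omega) (by omega) (by omega)
        have := h s _ _ hs hr
        rw [hg.1] at this
        rw [hg.zero, zero_add]; omega
      · obtain ⟨s, hs, hr⟩ := exists_gen (n := n) (p := m) (q := m + 1) (by omega) (by omega)
          (by omega) (fun m _ _ => by omega) (by omega) (by omega)
        exact h s _ _ hs hr
    · have e2 : g (m + 1) = m + 1 := hg.2 _ (by rw [lt_abs]; omega)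
      have e1 : g m ≤ m := by
        by_cases hm' : m ≤ n
        · have := abs_le.mp (hg.abs_le (m := m) (by rw [abs_le]; omega))
          omega
        · rw [hg.2 _ (by rw [lt_abs]; omega)]
      omega
  apply strictMono_int_of_lt_succ
  intro m
  by_cases hm : 0 ≤ m
  · exact hpos m hm
  · have := hpos (-(m + 1)) (by omega)
    rw [show -(m + 1) + 1 = -m by ring, hg.1, hg.1] at this
    omega

theorem eq_or_step {n : ℕ} {ω σ : Equiv.Perm ℤ} (hω : IsSigned n ω) (hσ : IsSigned n σ)
    (hsub : Iv n σ ⊆ Iv n ω) :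
    ω = σ ∨ ∃ s x, BGen n s ∧ IsSigned n (σ * s) ∧ AdjPos n σ x ∧ x ∉ Iv n σ ∧
      Iv n (σ * s) = insert x (Iv n σ) ∧ x ∈ Iv n ω := by
  by_cases H : ∀ s p q, BGen n s → AdjRefl n s p q → (ω⁻¹ * σ) p < (ω⁻¹ * σ) q
  · left
    have := signed_eq_one (hω.inv.mul hσ) H
    rw [inv_mul_eq_one] at this
    exact this
  · right
    push Not at H
    obtain ⟨s, p, q, hB, hs, hle⟩ := H
    have hpq : p < q := hs.2.2.1
    have hlt' : (ω⁻¹ * σ) q < (ω⁻¹ * σ) p := by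
      refine lt_of_le_of_ne hle fun e => ?_
      have := (ω⁻¹ * σ).injective e
      omega
    simp only [Equiv.Perm.mul_apply] at hlt'
    have hne : σ p ≠ σ q := fun e => by
      have := σ.injective e
      omega
    rcases lt_or_gt_of_ne hne with hlt | hgt
    · obtain ⟨x, h1, h2, h3, h4⟩ := step_cases hσ hs hlt
      refine ⟨s, x, hB, hσ.mul hs.isSigned, h1, h2, h3, ?_⟩
      rcases h4 with e | e
      · rw [mem_Iv_mk e]; exact hlt'
      · rw [mem_Iv_mk e, hω.inv_neg, hω.inv_neg]; omega
    · -- `(σ q, σ p)` is already an inversion of `σ`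
      exfalso
      have g1 : s p = q := by rw [hs.2.2.2.2.2.2]; simp
      have g2 : s q = p := by rw [hs.2.2.2.2.2.2]; simp [hpq.ne']
      obtain ⟨x, h1, h2, h3, h4⟩ := step_cases (hσ.mul hs.isSigned) hs (by simp [g1, g2]; omega)
      rw [mul_assoc, hs.sq, mul_one] at h3
      have hx : x ∈ Iv n ω := hsub (by rw [h3]; simp)
      simp only [Equiv.Perm.mul_apply, g1, g2] at h4
      rcases h4 with e | e
      · rw [mem_Iv_mk e] at hx; omega
      · rw [mem_Iv_mk e, hω.inv_neg, hω.inv_neg] at hx; omega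

theorem chain {n : ℕ} {ω : Equiv.Perm ℤ} (hω : IsSigned n ω) (N : ℕ) :
    ∀ σ : Equiv.Perm ℤ, IsSigned n σ → Iv n σ ⊆ Iv n ω → (Iv n ω).card - (Iv n σ).card ≤ N →
      ∃ l : List (Equiv.Perm ℤ), (∀ s ∈ l, BGen n s) ∧ ω = σ * l.prod ∧
        (Iv n ω).card = (Iv n σ).card + l.length ∧
        (IsInitialSection lamSE lamSTheta (Iv n σ) →
          IsInitialSection lamSE lamSTheta (Iv n ω)) := by
  induction N with
  | zero =>
    intro σ hσ hsub hN
    have heq : Iv n σ = Iv n ω := Finset.eq_of_subset_of_card_le hsub (by omega)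
    rcases eq_or_step hω hσ hsub with rfl | ⟨s, x, -, -, -, hx, -, hx'⟩
    · exact ⟨[], by simp, by simp, by simp, id⟩
    · exact absurd (heq ▸ hx') hx
  | succ N ih =>
    intro σ hσ hsub hN
    rcases eq_or_step hω hσ hsub with rfl | ⟨s, x, hB, hσs, hadj, hx, he, hx'⟩
    · exact ⟨[], by simp, by simp, by simp, id⟩
    · have hc : (Iv n (σ * s)).card = (Iv n σ).card + 1 := by
        rw [he, Finset.card_insert_of_notMem hx]
      obtain ⟨l, h1, h2, h3, h4⟩ := ih (σ * s) hσs
        (by rw [he]; exact Finset.insert_subset hx' hsub) (by omega)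
      refine ⟨s :: l, ?_, ?_, ?_, ?_⟩
      · intro t ht
        rcases List.mem_cons.mp ht with rfl | ht
        · exact hB
        · exact h1 t ht
      · rw [List.prod_cons, ← mul_assoc]; exact h2
      · rw [List.length_cons]; omega
      · intro hI
        apply h4
        rw [he]
        exact initial_insert hI (erasable_of_adj hσ x hadj)

theorem Iv_one (n : ℕ) : Iv n 1 = ∅ := by
  ext v
  have := v.2.2.2.1
  rw [mem_Iv]
  simp; omega

theorem Iv_card_zero (n : ℕ) (hn : ¬ 1 ≤ n) (A B : Finset (LamS n)) : A = B := by
  ext v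
  have h : Box n v.1 := v.2
  obtain ⟨h1, h2, h3, h4, h5⟩ := h
  have := abs_pos.mpr h1
  omega

theorem blen_eq {n : ℕ} {ω : Equiv.Perm ℤ} (hω : IsSigned n ω) : blen n ω = (Iv n ω).card := by
  obtain ⟨l, h1, h2, h3, -⟩ := chain hω _ 1 (IsSigned.one n) (by rw [Iv_one]; simp) le_rfl
  rw [Iv_one, Finset.card_empty, zero_add] at h3
  rw [one_mul] at h2
  have hmem : (Iv n ω).card ∈
      {k | ∃ l : List (Equiv.Perm ℤ), (∀ s ∈ l, BGen n s) ∧ l.length = k ∧ ω = l.prod} :=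
    ⟨l, h1, h3.symm, h2⟩
  apply le_antisymm
  · exact Nat.sInf_le hmem
  · apply le_csInf ⟨_, hmem⟩
    rintro k ⟨l', g1, rfl, g2⟩
    by_cases hn : 1 ≤ n
    · have := (word_card hn l' 1 (IsSigned.one n) g1).1
      rw [one_mul, ← g2, Iv_one, Finset.card_empty] at this
      omega
    · rw [Iv_card_zero n hn (Iv n ω) ∅]; simp

theorem weak_iff {n : ℕ} {σ ω : Equiv.Perm ℤ} (hσ : IsSigned n σ) (hω : IsSigned n ω) :
    BWeakLE n σ ω ↔ Iv n σ ⊆ Iv n ω := by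
  constructor
  · rintro ⟨l, h1, rfl, h3⟩
    by_cases hn : 1 ≤ n
    · rw [blen_eq hσ, blen_eq hω] at h3
      exact (word_card hn l σ hσ h1).2 h3
    · rw [Iv_card_zero n hn (Iv n σ) ∅]; simp
  · intro h
    obtain ⟨l, h1, h2, h3, -⟩ := chain hω _ σ hσ h le_rfl
    exact ⟨l, h1, h2, by rw [blen_eq hσ, blen_eq hω]; exact h3⟩

theorem Iv_injective {n : ℕ} {σ ω : Equiv.Perm ℤ} (hσ : IsSigned n σ) (hω : IsSigned n ω)
    (h : Iv n σ = Iv n ω) : σ = ω := by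
  obtain ⟨l, h1, h2, h3, -⟩ := chain hω _ σ hσ h.subset le_rfl
  rw [h] at h3
  have : l = [] := List.length_eq_zero_iff.mp (by omega)
  rw [h2, this]; simp

theorem Iv_initial {n : ℕ} {ω : Equiv.Perm ℤ} (hω : IsSigned n ω) :
    IsInitialSection lamSE lamSTheta (Iv n ω) := by
  obtain ⟨l, -, -, -, h⟩ := chain hω _ 1 (IsSigned.one n) (by rw [Iv_one]; simp) le_rfl
  apply h
  rw [Iv_one]
  exact ⟨[], trivial, rfl⟩

theorem initial_iff_s15 {n : ℕ} (A : Finset (LamS n)) :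
    IsInitialSection lamSE lamSTheta A ↔ ∃ ω : Equiv.Perm ℤ, IsSigned n ω ∧ A = Iv n ω := by
  constructor
  · intro hA
    refine initial_induct (P := fun A => ∃ ω : Equiv.Perm ℤ, IsSigned n ω ∧ A = Iv n ω)
      ⟨1, IsSigned.one n, (Iv_one n).symm⟩ ?_ hA
    rintro R x ⟨ω, hω, rfl⟩ hx
    have hadj := adj_of_erasable hω x hx
    have hxB : Box n (x.1.1, x.1.2) := x.2
    obtain ⟨b1, b2, b3, b4, b5⟩ := hxB
    simp only at b1 b2 b3 b4 b5
    have b4' := abs_le.mp b4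
    have i0 : x.1.2 ≠ 0 := by have := abs_pos.mpr b1; omega
    have i1 := abs_le.mp (hω.inv.abs_le (m := x.1.1) (by rw [abs_le]; omega))
    have i2 := abs_le.mp (hω.inv.abs_le (m := x.1.2) (by rw [abs_le]; omega))
    obtain ⟨s, hB, hs⟩ := exists_gen (n := n) (hω.inv.ne_zero b1) (hω.inv.ne_zero i0) hadj.1
      hadj.2 i1.1 i2.2
    have e1 : ω (ω⁻¹ x.1.1) = x.1.1 := by simp
    have e2 : ω (ω⁻¹ x.1.2) = x.1.2 := by simp
    obtain ⟨y, hy, -, -, he⟩ := step_insert hω hs (by rw [e1, e2]; exact b3)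
      (by rw [e1, e2]; exact b4)
    refine ⟨ω * s, hω.mul hs.isSigned, ?_⟩
    rw [he]
    have : y = x := by
      apply Subtype.ext
      refine hy.trans ?_
      rw [e1, e2]
    rw [this]
  · rintro ⟨ω, hω, rfl⟩
    exact Iv_initial hω

/-- the initial sections of the shifted valued digraph `ℬ` are
exactly the `B`-inversion sets of signed permutations, and the poset of initial
sections ordered by inclusion is isomorphic to the right weak order on `B_n`. -/
theorem shifted_initialSections_and_iso (n : ℕ) :
    (∀ A : Finset (LamS n),
        IsInitialSection lamSE lamSTheta A ↔
          ∃ ω : Equiv.Perm ℤ, IsSigned n ω ∧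
            (A : Set (LamS n)) = {v : LamS n | (v.1.1, v.1.2) ∈ InvBSet n ω}) ∧
    ∃ e : {ω : Equiv.Perm ℤ // IsSigned n ω} ≃
        {A : Finset (LamS n) // IsInitialSection lamSE lamSTheta A},
      ∀ σ ω : {ω : Equiv.Perm ℤ // IsSigned n ω},
        BWeakLE n σ.1 ω.1 ↔ (e σ).1 ⊆ (e ω).1 := by
  refine ⟨fun A => ?_, ?_⟩
  · rw [initial_iff_s15]
    refine exists_congr fun ω => and_congr_right fun _ => ?_
    rw [← Iv_coe, Finset.coe_inj]
  · refine ⟨Equiv.ofBijective (fun ω => ⟨Iv n ω.1, Iv_initial ω.2⟩) ⟨?_, ?_⟩, ?_⟩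
    · intro σ ω h
      exact Subtype.ext (Iv_injective σ.2 ω.2 (congrArg Subtype.val h))
    · rintro ⟨A, hA⟩
      obtain ⟨ω, hω, rfl⟩ := (initial_iff_s15 A).mp hA
      exact ⟨⟨ω, hω⟩, rfl⟩
    · intro σ ω
      exact weak_iff σ.2 ω.2
end
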